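/- arXiv:2306.06626 — 2 statements merged into one kernel-verified Lean document; each statement's English description precedes it below -/
import Mathlib

section
/- For any normalized finite dataset of n points in ℝ^d, the data separation function satisfies ∫₀^∞ |1 − λ(s)| ds ≤ 3 n / √d. (Theorem 4.1 of the paper.) -/
open MeasureTheory ProbabilityTheory Real

/-- Standard Gaussian measure `N(0, I_d)` on `ℝ^d`. -/
noncomputable def stdGaussian (d : ℕ) : Measure (EuclideanSpace ℝ (Fin d)) :=
  (Measure.pi fun _ : Fin d => gaussianReal 0 1).map (EuclideanSpace.equiv (Fin d) ℝ).symm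

/-- Softmax posterior weights `ρ_s(x_i | y)`. -/
noncomputable def rho (d n : ℕ) (s : ℝ) (x : Fin n → EuclideanSpace ℝ (Fin d))
    (i : Fin n) (y : EuclideanSpace ℝ (Fin d)) : ℝ :=
  Real.exp (-(s ^ 2 / 2) * ‖x i - y‖ ^ 2) / ∑ l, Real.exp (-(s ^ 2 / 2) * ‖x l - y‖ ^ 2)

/-- The data separation function `λ(s)`. -/
noncomputable def lamSep (d n : ℕ) (x : Fin n → EuclideanSpace ℝ (Fin d)) (s : ℝ) : ℝ :=
  (1 / ((d : ℝ) * n)) *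
    ∑ j, ∫ z, ‖∑ i, rho d n s x i (x j + s⁻¹ • z) • x i‖ ^ 2 ∂ stdGaussian d

instance stdGaussian_isProb (d : ℕ) : IsProbabilityMeasure (_root_.stdGaussian d) := by
  unfold _root_.stdGaussian
  exact Measure.isProbabilityMeasure_map (by fun_prop)

lemma gauss_exp (d : ℕ) (a : EuclideanSpace ℝ (Fin d)) :
    Integrable (fun z => Real.exp (inner ℝ a z)) (_root_.stdGaussian d) ∧
    ∫ z, Real.exp (inner ℝ a z) ∂(_root_.stdGaussian d) = Real.exp (‖a‖ ^ 2 / 2) := by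
  have hm : Measurable (EuclideanSpace.equiv (Fin d) ℝ).symm := by fun_prop
  have hf : Continuous (fun z : EuclideanSpace ℝ (Fin d) => Real.exp (inner ℝ a z)) := by fun_prop
  have key : ∀ y : Fin d → ℝ, Real.exp (inner ℝ a ((EuclideanSpace.equiv (Fin d) ℝ).symm y))
      = ∏ i, Real.exp (a i * y i) := by
    intro y
    rw [← Real.exp_sum]
    congr 1
    simp [PiLp.inner_apply, mul_comm]
  have h1 : ∀ i : Fin d, Integrable (fun t => Real.exp (a i * t)) (gaussianReal 0 1) :=
    fun i => integrable_exp_mul_gaussianReal (a i)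
  have h2 : ∀ i : Fin d, ∫ t, Real.exp (a i * t) ∂(gaussianReal 0 1) = Real.exp (a i ^ 2 / 2) := by
    intro i
    have := mgf_gaussianReal (p := gaussianReal 0 1) (X := id) (μ := 0) (v := 1) (by simp) (a i)
    simpa [mgf] using this
  unfold _root_.stdGaussian
  constructor
  · rw [integrable_map_measure hf.aestronglyMeasurable hm.aemeasurable]
    simp only [Function.comp_def, key]
    exact Integrable.fintype_prod (f := fun i t => Real.exp (a i * t)) h1
  · rw [integral_map hm.aemeasurable hf.aestronglyMeasurable]
    simp only [key]
    rw [integral_fintype_prod_eq_prod (f := fun i t => Real.exp (a i * t))]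
    simp only [h2]
    rw [← Real.exp_sum, EuclideanSpace.norm_sq_eq, Finset.sum_div]
    simp

section
variable {d n : ℕ} (x : Fin n → EuclideanSpace ℝ (Fin d))

lemma rho_nonneg' (s : ℝ) (i : Fin n) (y) : 0 ≤ rho d n s x i y := by
  unfold rho; positivity

lemma rho_sum' (s : ℝ) (j : Fin n) (y) : ∑ i, rho d n s x i y = 1 := by
  unfold rho
  rw [← Finset.sum_div]
  apply div_self
  have : 0 < ∑ l, Real.exp (-(s ^ 2 / 2) * ‖x l - y‖ ^ 2) :=
    Finset.sum_pos (fun _ _ => Real.exp_pos _) ⟨j, Finset.mem_univ j⟩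
  exact this.ne'

/-- Majorant of `2 ρ_i`. -/
noncomputable def G (s : ℝ) (i j : Fin n) (z : EuclideanSpace ℝ (Fin d)) : ℝ :=
  Real.exp (-(s ^ 2 / 4) * ‖x i - x j‖ ^ 2) * Real.exp (inner ℝ ((s / 2) • (x i - x j)) z)

lemma G_int (s : ℝ) (i j : Fin n) : Integrable (G x s i j) (_root_.stdGaussian d) ∧
    ∫ z, G x s i j z ∂(_root_.stdGaussian d) = Real.exp (-(‖x i - x j‖ ^ 2 / 8) * s ^ 2) := by
  obtain ⟨h1, h2⟩ := gauss_exp d ((s / 2) • (x i - x j))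
  refine ⟨h1.const_mul _, ?_⟩
  unfold G
  rw [integral_const_mul, h2, ← Real.exp_add]
  congr 1
  rw [norm_smul, mul_pow, Real.norm_eq_abs, sq_abs]
  ring

lemma rho_le (s : ℝ) (hs : 0 < s) (i j : Fin n) (hij : i ≠ j) (z : EuclideanSpace ℝ (Fin d)) :
    2 * rho d n s x i (x j + s⁻¹ • z) ≤ G x s i j z := by
  set y := x j + s⁻¹ • z with hy
  set u := -(s ^ 2 / 4) * ‖x i - y‖ ^ 2
  set v := -(s ^ 2 / 4) * ‖x j - y‖ ^ 2
  have hG : G x s i j z = Real.exp u / Real.exp v := by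
    unfold G
    rw [← Real.exp_add, ← Real.exp_sub]
    congr 1
    have e1 : x i - y = (x i - x j) - s⁻¹ • z := by rw [hy]; abel
    have e2 : x j - y = - (s⁻¹ • z) := by rw [hy]; abel
    simp only [u, v]
    rw [e1, e2, norm_neg, norm_sub_sq_real (x i - x j), inner_smul_left, inner_smul_right]
    simp only [conj_trivial]
    field_simp
    ring
  have hS : Real.exp u ^ 2 + Real.exp v ^ 2 ≤ ∑ l, Real.exp (-(s ^ 2 / 2) * ‖x l - y‖ ^ 2) := by
    have e : Real.exp u ^ 2 + Real.exp v ^ 2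
        = ∑ l ∈ {i, j}, Real.exp (-(s ^ 2 / 2) * ‖x l - y‖ ^ 2) := by
      rw [Finset.sum_pair hij, ← Real.exp_nat_mul, ← Real.exp_nat_mul]
      congr 2 <;> simp only [u, v] <;> push_cast <;> ring
    rw [e]
    exact Finset.sum_le_sum_of_subset_of_nonneg (Finset.subset_univ _)
      (fun _ _ _ => (Real.exp_pos _).le)
  have hu := Real.exp_pos u
  have hv := Real.exp_pos v
  have hn : Real.exp (-(s ^ 2 / 2) * ‖x i - y‖ ^ 2) = Real.exp u ^ 2 := by
    rw [← Real.exp_nat_mul]; congr 1; simp only [u]; push_cast; ring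
  rw [hG]
  unfold rho
  rw [hn, ← mul_div_assoc, div_le_div_iff₀ (by nlinarith) hv]
  have := two_mul_le_add_sq (Real.exp u) (Real.exp v)
  nlinarith

lemma D_rho_le (s : ℝ) (hs : 0 < s) (i j : Fin n) (z : EuclideanSpace ℝ (Fin d)) :
    2 * rho d n s x i (x j + s⁻¹ • z) * ‖x i - x j‖ ≤ G x s i j z * ‖x i - x j‖ := by
  by_cases h : i = j
  · subst h; simp
  · exact mul_le_mul_of_nonneg_right (rho_le x s hs i j h z) (norm_nonneg _)

/-- the squared posterior mean -/
noncomputable def F (s : ℝ) (j : Fin n) (z : EuclideanSpace ℝ (Fin d)) : ℝ :=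
  ‖∑ i, rho d n s x i (x j + s⁻¹ • z) • x i‖ ^ 2

lemma F_upper (s : ℝ) (hs : 0 < s) (j : Fin n) (z : EuclideanSpace ℝ (Fin d)) :
    ‖x j‖ ^ 2 - F x s j z ≤ ∑ i, ‖x j‖ * ‖x i - x j‖ * G x s i j z := by
  have hsum := rho_sum' x s j (x j + s⁻¹ • z)
  have hle := fun i => D_rho_le x s hs i j z
  have h0 := fun i => rho_nonneg' x s i (x j + s⁻¹ • z)
  unfold F
  set r := fun i => rho d n s x i (x j + s⁻¹ • z) with hr
  change ‖x j‖ ^ 2 - ‖∑ i, r i • x i‖ ^ 2 ≤ _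
  change ∑ i, r i = 1 at hsum
  set m := ∑ i, r i • x i with hm
  have h1 : ‖x j‖ ^ 2 - ‖m‖ ^ 2 ≤ 2 * inner ℝ (x j) (x j - m) := by
    rw [inner_sub_right, real_inner_self_eq_norm_sq]
    have := norm_sub_sq_real (x j) m
    nlinarith [sq_nonneg ‖x j - m‖]
  have h2 : x j - m = ∑ i, r i • (x j - x i) := by
    simp_rw [smul_sub, Finset.sum_sub_distrib, ← Finset.sum_smul, hsum, one_smul, hm]
  refine h1.trans ?_
  rw [h2, inner_sum, Finset.mul_sum]
  refine Finset.sum_le_sum fun i _ => ?_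
  rw [inner_smul_right]
  have h3 : inner ℝ (x j) (x j - x i) ≤ ‖x j‖ * ‖x i - x j‖ := by
    rw [norm_sub_rev (x i)]; exact real_inner_le_norm _ _
  have h4 := mul_le_mul_of_nonneg_left h3 (h0 i)
  have h5 := mul_le_mul_of_nonneg_left (hle i) (norm_nonneg (x j))
  simp only [hr] at *
  nlinarith

lemma F_convex (s : ℝ) (j : Fin n) (z : EuclideanSpace ℝ (Fin d)) :
    F x s j z ≤ ∑ i, rho d n s x i (x j + s⁻¹ • z) * ‖x i‖ ^ 2 := by
  have hsum := rho_sum' x s j (x j + s⁻¹ • z)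
  have h0 := fun i => rho_nonneg' x s i (x j + s⁻¹ • z)
  unfold F
  have hc : ConvexOn ℝ Set.univ (fun v : EuclideanSpace ℝ (Fin d) => ‖v‖ ^ 2) :=
    (convexOn_norm convex_univ).pow (fun _ _ => norm_nonneg _) 2
  have := hc.map_sum_le (t := Finset.univ) (w := fun i => rho d n s x i (x j + s⁻¹ • z))
    (p := x) (fun i _ => h0 i) hsum (fun _ _ => Set.mem_univ _)
  simpa using this

lemma F_lower (s : ℝ) (hs : 0 < s) (j : Fin n) (z : EuclideanSpace ℝ (Fin d)) :
    F x s j z - ‖x j‖ ^ 2 ≤ ∑ i, (‖x i‖ + ‖x j‖) / 2 * ‖x i - x j‖ * G x s i j z := by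
  have hsum := rho_sum' x s j (x j + s⁻¹ • z)
  have h0 := fun i => rho_nonneg' x s i (x j + s⁻¹ • z)
  have h1 := F_convex x s j z
  have h2 : F x s j z - ‖x j‖ ^ 2
      ≤ ∑ i, rho d n s x i (x j + s⁻¹ • z) * (‖x i‖ ^ 2 - ‖x j‖ ^ 2) := by
    simp_rw [mul_sub, Finset.sum_sub_distrib, ← Finset.sum_mul, hsum]
    linarith
  refine h2.trans (Finset.sum_le_sum fun i _ => ?_)
  have h3 := norm_sub_norm_le (x i) (x j)
  have h4 : ‖x i‖ ^ 2 - ‖x j‖ ^ 2 ≤ (‖x i‖ + ‖x j‖) * ‖x i - x j‖ := by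
    have := mul_le_mul_of_nonneg_left h3 (add_nonneg (norm_nonneg (x i)) (norm_nonneg (x j)))
    linarith
  have h5 := mul_le_mul_of_nonneg_left h4 (h0 i)
  have h6 := mul_le_mul_of_nonneg_left (D_rho_le x s hs i j z)
    (add_nonneg (norm_nonneg (x i)) (norm_nonneg (x j)))
  nlinarith

lemma F_meas (j : Fin n) :
    Measurable (fun p : ℝ × EuclideanSpace ℝ (Fin d) => F x p.1 j p.2) := by
  unfold F rho
  fun_prop

lemma F_integrable (s : ℝ) (j : Fin n) : Integrable (F x s j) (_root_.stdGaussian d) := by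
  refine Integrable.of_bound (C := ∑ i, ‖x i‖ ^ 2)
    ((F_meas x j).comp (measurable_prodMk_left (x := s))).aestronglyMeasurable ?_
  refine Filter.Eventually.of_forall fun z => ?_
  have hsum := rho_sum' x s j (x j + s⁻¹ • z)
  have h0 := fun i => rho_nonneg' x s i (x j + s⁻¹ • z)
  rw [Real.norm_of_nonneg (by unfold F; positivity)]
  refine (F_convex x s j z).trans (Finset.sum_le_sum fun i _ => ?_)
  have : rho d n s x i (x j + s⁻¹ • z) ≤ 1 := by
    rw [← hsum]; exact Finset.single_le_sum (fun i _ => h0 i) (Finset.mem_univ i)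
  exact mul_le_of_le_one_left (by positivity) this

/-- the integrated majorant -/
noncomputable def B (s : ℝ) : ℝ :=
  ∑ j, ∑ i, ‖x j‖ * (‖x i - x j‖ * Real.exp (-(‖x i - x j‖ ^ 2 / 8) * s ^ 2))

lemma bound_one (s : ℝ) (hs : 0 < s) :
    |∑ j, (‖x j‖ ^ 2 - ∫ z, F x s j z ∂(_root_.stdGaussian d))| ≤ B x s := by
  have hI : ∀ (c : Fin n → ℝ) (j : Fin n),
      Integrable (fun z => ∑ i, c i * ‖x i - x j‖ * G x s i j z) (_root_.stdGaussian d) :=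
    fun c j => integrable_finsetSum _ fun i _ => (G_int x s i j).1.const_mul _
  have hV : ∀ (c : Fin n → ℝ) (j : Fin n),
      ∫ z, (∑ i, c i * ‖x i - x j‖ * G x s i j z) ∂(_root_.stdGaussian d)
        = ∑ i, c i * (‖x i - x j‖ * Real.exp (-(‖x i - x j‖ ^ 2 / 8) * s ^ 2)) := by
    intro c j
    rw [integral_finsetSum _ fun i _ => (G_int x s i j).1.const_mul _]
    refine Finset.sum_congr rfl fun i _ => ?_
    rw [integral_const_mul, (G_int x s i j).2]
    ring
  have hc : ∀ j, ∫ z, (‖x j‖ ^ 2 - F x s j z) ∂(_root_.stdGaussian d)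
      = ‖x j‖ ^ 2 - ∫ z, F x s j z ∂(_root_.stdGaussian d) := by
    intro j
    rw [integral_sub (integrable_const _) (F_integrable x s j)]
    simp
  have hc' : ∀ j, ∫ z, (F x s j z - ‖x j‖ ^ 2) ∂(_root_.stdGaussian d)
      = (∫ z, F x s j z ∂(_root_.stdGaussian d)) - ‖x j‖ ^ 2 := by
    intro j
    rw [integral_sub (F_integrable x s j) (integrable_const _)]
    simp
  rw [abs_le']
  constructor
  · unfold B
    refine Finset.sum_le_sum fun j _ => ?_
    rw [← hc, ← hV (fun _ => ‖x j‖) j]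
    exact integral_mono ((integrable_const _).sub (F_integrable x s j)) (hI _ j)
      (F_upper x s hs j)
  · rw [← Finset.sum_neg_distrib]
    have h1 : ∑ j, -(‖x j‖ ^ 2 - ∫ z, F x s j z ∂(_root_.stdGaussian d)) ≤
        ∑ j, ∑ i, (‖x i‖ + ‖x j‖) / 2 *
          (‖x i - x j‖ * Real.exp (-(‖x i - x j‖ ^ 2 / 8) * s ^ 2)) := by
      refine Finset.sum_le_sum fun j _ => ?_
      rw [neg_sub, ← hc', ← hV (fun i => (‖x i‖ + ‖x j‖) / 2) j]
      exact integral_mono ((F_integrable x s j).sub (integrable_const _)) (hI _ j)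
        (F_lower x s hs j)
    refine h1.trans (le_of_eq ?_)
    have h2 : B x s = ∑ j, ∑ i, ‖x i‖ *
        (‖x i - x j‖ * Real.exp (-(‖x i - x j‖ ^ 2 / 8) * s ^ 2)) := by
      unfold B
      rw [Finset.sum_comm]
      refine Finset.sum_congr rfl fun j _ => Finset.sum_congr rfl fun i _ => ?_
      rw [norm_sub_rev]
    have h3 : B x s = (B x s + B x s) / 2 := by ring
    rw [h3]
    nth_rw 1 [h2]
    unfold B
    rw [← Finset.sum_add_distrib, Finset.sum_div]
    refine Finset.sum_congr rfl fun j _ => ?_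
    rw [← Finset.sum_add_distrib, Finset.sum_div]
    refine Finset.sum_congr rfl fun i _ => ?_
    ring

lemma term_int (D : ℝ) (hD : 0 ≤ D) :
    IntegrableOn (fun s => D * Real.exp (-(D ^ 2 / 8) * s ^ 2)) (Set.Ioi 0) ∧
    ∫ s in Set.Ioi (0:ℝ), D * Real.exp (-(D ^ 2 / 8) * s ^ 2) ≤ 3 := by
  rcases hD.eq_or_lt with h | h
  · subst h; simp
  · refine ⟨((integrable_exp_neg_mul_sq (by positivity)).const_mul _).integrableOn, ?_⟩
    rw [integral_const_mul, integral_gaussian_Ioi]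
    have h1 : √(π / (D ^ 2 / 8)) ≤ 6 / D := by
      apply Real.sqrt_le_iff.2
      refine ⟨by positivity, ?_⟩
      rw [div_pow, div_le_div_iff₀ (by positivity) (by positivity)]
      have := Real.pi_lt_four
      nlinarith [sq_nonneg D]
    calc D * (√(π / (D ^ 2 / 8)) / 2) ≤ D * (6 / D / 2) := by gcongr
      _ = 3 := by field_simp; norm_num

lemma B_int : IntegrableOn (B x) (Set.Ioi 0) ∧
    ∫ s in Set.Ioi (0:ℝ), B x s ≤ 3 * n * ∑ j, ‖x j‖ := by
  have h := fun i j => term_int ‖x i - x j‖ (norm_nonneg _)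
  have hi : ∀ j i : Fin n, Integrable (fun s => ‖x j‖ * (‖x i - x j‖ *
      Real.exp (-(‖x i - x j‖ ^ 2 / 8) * s ^ 2))) (volume.restrict (Set.Ioi 0)) :=
    fun j i => (h i j).1.const_mul _
  have hj := fun j : Fin n => integrable_finsetSum Finset.univ fun i _ => hi j i
  refine ⟨integrable_finsetSum _ fun j _ => hj j, ?_⟩
  unfold B
  rw [integral_finsetSum _ fun j _ => hj j, Finset.mul_sum]
  refine Finset.sum_le_sum fun j _ => ?_
  rw [integral_finsetSum _ fun i _ => hi j i]
  have : ∀ i ∈ Finset.univ, ∫ s in Set.Ioi (0:ℝ), ‖x j‖ * (‖x i - x j‖ *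
      Real.exp (-(‖x i - x j‖ ^ 2 / 8) * s ^ 2)) ≤ ‖x j‖ * 3 := by
    intro i _
    rw [integral_const_mul]
    exact mul_le_mul_of_nonneg_left (h i j).2 (norm_nonneg _)
  refine (Finset.sum_le_card_nsmul _ _ _ this).trans (le_of_eq ?_)
  simp
  ring

lemma lamSep_meas : Measurable (lamSep d n x) := by
  have : lamSep d n x = fun s => (1 / ((d : ℝ) * n)) *
    ∑ j, ∫ z, F x s j z ∂(_root_.stdGaussian d) := rfl
  rw [this]
  refine Measurable.const_mul (Finset.measurable_sum _ fun j _ => ?_) _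
  exact (StronglyMeasurable.integral_prod_right (F_meas x j).stronglyMeasurable).measurable

end

/-- Theorem 4.1: for a normalized finite dataset of `n` points in `ℝ^d`,
`∫₀^∞ |1 − λ(s)| ds ≤ 3 n / √d`. -/
theorem integral_abs_one_sub_lamSep_le (d n : ℕ) (hd : 1 ≤ d) (hn : 1 ≤ n)
    (x : Fin n → EuclideanSpace ℝ (Fin d))
    (hmean : (n : ℝ)⁻¹ • ∑ i, x i = 0)
    (hvar : 1 / ((d : ℝ) * n) * ∑ i, ‖x i‖ ^ 2 = 1) :
    IntegrableOn (fun s => |1 - lamSep d n x s|) (Set.Ioi 0) ∧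
      ∫ s in Set.Ioi (0 : ℝ), |1 - lamSep d n x s| ≤ 3 * n / Real.sqrt d := by
  have hd0 : (0:ℝ) < d := by exact_mod_cast hd
  have hn0 : (0:ℝ) < n := by exact_mod_cast hn
  have hb : ∀ s ∈ Set.Ioi (0:ℝ), |1 - lamSep d n x s| ≤ 1 / ((d : ℝ) * n) * B x s := by
    intro s hs
    have e : 1 - lamSep d n x s = 1 / ((d : ℝ) * n) *
        ∑ j, (‖x j‖ ^ 2 - ∫ z, F x s j z ∂(_root_.stdGaussian d)) := by
      rw [Finset.sum_sub_distrib, mul_sub, hvar]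
      rfl
    rw [e, abs_mul, abs_of_pos (by positivity : (0:ℝ) < 1 / ((d : ℝ) * n))]
    exact mul_le_mul_of_nonneg_left (bound_one x s hs) (by positivity)
  obtain ⟨hB, hB2⟩ := B_int x
  have hB' : IntegrableOn (fun s => 1 / ((d : ℝ) * n) * B x s) (Set.Ioi 0) := hB.const_mul _
  have hint : IntegrableOn (fun s => |1 - lamSep d n x s|) (Set.Ioi 0) := by
    refine Integrable.mono' hB' ?_ ?_
    · have := lamSep_meas x
      have h2 : Measurable (fun s => |1 - lamSep d n x s|) := by fun_prop
      exact h2.aestronglyMeasurable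
    · refine (ae_restrict_iff' measurableSet_Ioi).2 (Filter.Eventually.of_forall fun s hs => ?_)
      rw [Real.norm_eq_abs, abs_abs]
      exact hb s hs
  refine ⟨hint, (setIntegral_mono_on hint hB' measurableSet_Ioi hb).trans ?_⟩
  rw [integral_const_mul]
  have hq : ∑ i, ‖x i‖ ^ 2 = d * n := by
    field_simp at hvar
    linarith
  have hs : ∑ j, ‖x j‖ ≤ n * √d := by
    have h1 := sq_sum_le_card_mul_sum_sq (s := Finset.univ) (f := fun j => ‖x j‖)
    rw [hq] at h1
    simp only [Finset.card_univ, Fintype.card_fin] at h1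
    refine (pow_le_pow_iff_left₀ (by positivity) (by positivity) two_ne_zero).1 ?_
    rw [mul_pow, Real.sq_sqrt hd0.le]
    linarith
  calc 1 / ((d : ℝ) * n) * ∫ s in Set.Ioi (0:ℝ), B x s
      ≤ 1 / ((d : ℝ) * n) * (3 * n * (n * √d)) := by
        gcongr
        exact hB2.trans (by gcongr)
    _ = 3 * n / √d := by
        have h := Real.sq_sqrt hd0.le
        have h' : 0 < √d := Real.sqrt_pos.2 hd0
        field_simp
        linarith
end

section
/- Let (a_t, m_t) be a scheduler pair such that a_t/m_t is strictly monotonically increasing on (0,1) and ‖a‖_{1,∞} ≤ M, ‖m‖_{1,∞} ≤ M for some M > 0. Then for any normalized finite dataset of n points in ℝ^d, 0 ≤ ∫₀¹ β_t² (1 − λ(a_t/m_t)) dt ≤ 6 M² n / √d. (This integral is the gap E_c(a,m) − E(a,m) between the conditional and marginal kinetic energies, so E_c(a,m) − 6M² n/√d ≤ E(a,m) ≤ E_c(a,m); Theorem 4.2 of the paper.) -/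
open MeasureTheory ProbabilityTheory Real

/-- The Cameron-Martin weight. -/
noncomputable def cmW {d : ℕ} (c z : EuclideanSpace ℝ (Fin d)) : ℝ :=
  Real.exp (inner ℝ c z - ‖c‖ ^ 2 / 2)

lemma gauss_shift_one (c : ℝ) :
    (gaussianReal 0 1).withDensity (fun x => ENNReal.ofReal (Real.exp (c * x - c ^ 2 / 2)))
      = gaussianReal c 1 := by
  rw [gaussianReal_of_var_ne_zero _ one_ne_zero, gaussianReal_of_var_ne_zero _ one_ne_zero,
    ← withDensity_mul _ (measurable_gaussianPDF _ _) (by fun_prop)]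
  congr 1
  ext x
  simp only [Pi.mul_apply, gaussianPDF, gaussianPDFReal]
  rw [← ENNReal.ofReal_mul (by positivity)]
  congr 1
  rw [mul_assoc, ← Real.exp_add]
  congr 2
  push_cast
  ring

lemma gauss_shift_pi (d : ℕ) (c : Fin d → ℝ) :
    (Measure.pi fun _ : Fin d => gaussianReal 0 1).withDensity
      (fun z => ∏ i, ENNReal.ofReal (Real.exp (c i * z i - c i ^ 2 / 2)))
      = Measure.pi fun i => gaussianReal (c i) 1 := by
  symm
  apply Measure.pi_eq
  intro s hs
  rw [withDensity_apply _ (MeasurableSet.univ_pi hs), ← lintegral_indicator (MeasurableSet.univ_pi hs)]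
  have h1 : ∀ z : Fin d → ℝ, (Set.univ.pi s).indicator
      (fun z => ∏ i, ENNReal.ofReal (Real.exp (c i * z i - c i ^ 2 / 2))) z
      = ∏ i, (s i).indicator (fun x => ENNReal.ofReal (Real.exp (c i * x - c i ^ 2 / 2))) (z i) := by
    intro z
    by_cases hz : z ∈ Set.univ.pi s
    · rw [Set.indicator_of_mem hz]
      apply Finset.prod_congr rfl
      intro i _
      rw [Set.indicator_of_mem (hz i (Set.mem_univ i))]
    · rw [Set.indicator_of_notMem hz]
      simp only [Set.mem_pi, Set.mem_univ, true_implies, not_forall] at hz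
      obtain ⟨i, hi⟩ := hz
      symm
      apply Finset.prod_eq_zero (Finset.mem_univ i)
      rw [Set.indicator_of_notMem hi]
  simp_rw [h1]
  have hm : ∀ i, Measurable ((s i).indicator
      (fun x => ENNReal.ofReal (Real.exp (c i * x - c i ^ 2 / 2)))) := fun i =>
    Measurable.indicator (by fun_prop) (hs i)
  rw [lintegral_prod_eq_prod_lintegral_of_indepFun Finset.univ
    (fun i (z : Fin d → ℝ) => (s i).indicator
      (fun x => ENNReal.ofReal (Real.exp (c i * x - c i ^ 2 / 2))) (z i))
    (iIndepFun_pi (fun i => (hm i).aemeasurable))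
    (fun i => (hm i).comp (measurable_pi_apply i))]
  apply Finset.prod_congr rfl
  intro i _
  rw [← gauss_shift_one (c i), withDensity_apply _ (hs i), ← lintegral_indicator (hs i)]
  exact (measurePreserving_eval (fun _ : Fin d => gaussianReal 0 1) i).lintegral_comp (hm i)

lemma gauss_shift_measure (d : ℕ) (c : EuclideanSpace ℝ (Fin d)) :
    (_root_.stdGaussian d).map (fun z => c + z)
      = (_root_.stdGaussian d).withDensity (fun z => ENNReal.ofReal (cmW c z)) := by
  have hme : Measurable (EuclideanSpace.equiv (Fin d) ℝ).symm :=
    (EuclideanSpace.equiv (Fin d) ℝ).symm.continuous.measurable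
  have hcm : Measurable fun z : EuclideanSpace ℝ (Fin d) => ENNReal.ofReal (cmW c z) := by
    unfold cmW
    fun_prop
  have h2 : Measure.pi (fun i => gaussianReal (c i) 1)
      = (Measure.pi fun _ : Fin d => gaussianReal 0 1).map (fun z i => c i + z i) := by
    have := Measure.pi_map_pi (μ := fun _ : Fin d => gaussianReal 0 1)
      (f := fun i x => c i + x) (fun i => by fun_prop)
    rw [this]
    congr 1
    ext1 i
    rw [gaussianReal_map_const_add, zero_add]
  ext S hS
  rw [Measure.map_apply (by fun_prop) hS, withDensity_apply _ hS]
  unfold _root_.stdGaussian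
  rw [Measure.map_apply hme (measurable_const_add c hS),
    setLIntegral_map hS hcm hme]
  have h3 : ∀ z : Fin d → ℝ, ENNReal.ofReal (cmW c ((EuclideanSpace.equiv (Fin d) ℝ).symm z))
      = ∏ i, ENNReal.ofReal (Real.exp (c i * z i - c i ^ 2 / 2)) := by
    intro z
    rw [← ENNReal.ofReal_prod_of_nonneg (fun i _ => (Real.exp_pos _).le), ← Real.exp_sum]
    unfold cmW
    congr 2
    rw [EuclideanSpace.real_norm_sq_eq, PiLp.inner_apply, Finset.sum_sub_distrib, Finset.sum_div]
    simp [mul_comm]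
  simp_rw [h3]
  rw [← withDensity_apply _ (hme hS), gauss_shift_pi, h2,
    Measure.map_apply (by fun_prop) (hme hS)]
  rfl

lemma gauss_shift_integral (d : ℕ) (c : EuclideanSpace ℝ (Fin d))
    (f : EuclideanSpace ℝ (Fin d) → ℝ) :
    ∫ z, f (c + z) ∂(_root_.stdGaussian d) = ∫ z, cmW c z * f z ∂(_root_.stdGaussian d) := by
  have h := (measurableEmbedding_addLeft c).integral_map (μ := _root_.stdGaussian d) f
  rw [← h, gauss_shift_measure, integral_withDensity_eq_integral_toReal_smul]
  · apply integral_congr_ae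
    filter_upwards with z
    rw [ENNReal.toReal_ofReal (by unfold cmW; positivity), smul_eq_mul]
  · unfold cmW
    fun_prop
  · filter_upwards with z
    exact ENNReal.ofReal_lt_top

instance stdG_prob (d : ℕ) : IsProbabilityMeasure (_root_.stdGaussian d) := by
  unfold _root_.stdGaussian
  exact Measure.isProbabilityMeasure_map
    (EuclideanSpace.equiv (Fin d) ℝ).symm.continuous.measurable.aemeasurable

lemma integral_cmW (d : ℕ) (c : EuclideanSpace ℝ (Fin d)) :
    ∫ z, cmW c z ∂(_root_.stdGaussian d) = 1 := by
  have := gauss_shift_integral d c (fun _ => 1)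
  simpa using this.symm

lemma integrable_cmW (d : ℕ) (c : EuclideanSpace ℝ (Fin d)) :
    Integrable (fun z => cmW c z) (_root_.stdGaussian d) := by
  by_contra h
  have := integral_undef h
  rw [integral_cmW] at this
  exact one_ne_zero this

/-- algebra: weighted variance identity -/
lemma var_identity {E : Type*} [NormedAddCommGroup E] [InnerProductSpace ℝ E] (n : ℕ)
    (w : Fin n → ℝ) (x : Fin n → E) (hW : 0 < ∑ l, w l) :
    ∑ j, w j * ‖x j‖ ^ 2 - (∑ l, w l) * ‖∑ i, (w i / ∑ l, w l) • x i‖ ^ 2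
      = ∑ i, ∑ k, (1 / 2) * (w i * w k / (∑ l, w l)) * ‖x i - x k‖ ^ 2 := by
  set W := ∑ l, w l with hWd
  have h1 : ∑ i, (w i / W) • x i = W⁻¹ • ∑ i, w i • x i := by
    rw [Finset.smul_sum]
    apply Finset.sum_congr rfl
    intro i _
    rw [smul_smul]; congr 1; ring
  have h2 : ‖∑ i, w i • x i‖ ^ 2 = ∑ i, ∑ k, w i * w k * inner ℝ (x i) (x k) := by
    rw [← real_inner_self_eq_norm_sq, sum_inner]
    apply Finset.sum_congr rfl
    intro i _
    rw [inner_sum]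
    apply Finset.sum_congr rfl
    intro k _
    rw [real_inner_smul_left, real_inner_smul_right]; ring
  rw [h1, norm_smul, mul_pow, h2]
  have h3 : ∀ i k, (1 / 2) * (w i * w k / W) * ‖x i - x k‖ ^ 2
      = W⁻¹ * ((1/2) * (w i * ‖x i‖ ^ 2 * w k) + (1/2) * (w i * (w k * ‖x k‖ ^ 2))
         - w i * w k * inner ℝ (x i) (x k)) := by
    intro i k
    rw [norm_sub_sq_real]; ring
  have hA : ∑ i, ∑ k, w i * ‖x i‖ ^ 2 * w k = (∑ i, w i * ‖x i‖ ^ 2) * W := by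
    rw [hWd, Finset.sum_mul_sum]
  have hB : ∑ i, ∑ k, w i * (w k * ‖x k‖ ^ 2) = W * (∑ i, w i * ‖x i‖ ^ 2) := by
    rw [hWd, Finset.sum_mul_sum]
  have hC : ∑ i, ∑ k, (1 / 2) * (w i * w k / W) * ‖x i - x k‖ ^ 2
      = W⁻¹ * ((1/2) * (∑ i, ∑ k, w i * ‖x i‖ ^ 2 * w k)
        + (1/2) * (∑ i, ∑ k, w i * (w k * ‖x k‖ ^ 2))
        - ∑ i, ∑ k, w i * w k * inner ℝ (x i) (x k)) := by
    simp_rw [h3, Finset.mul_sum, ← Finset.sum_add_distrib, ← Finset.sum_sub_distrib,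
      Finset.mul_sum]
  rw [hC, hA, hB, Real.norm_eq_abs, abs_of_pos (inv_pos.2 hW)]
  field_simp
  ring

lemma rho_eq (d n : ℕ) (s : ℝ) (hs : 0 < s) (x : Fin n → EuclideanSpace ℝ (Fin d))
    (i : Fin n) (z : EuclideanSpace ℝ (Fin d)) :
    rho d n s x i (s⁻¹ • z) = cmW (s • x i) z / ∑ l, cmW (s • x l) z := by
  have h : ∀ l, Real.exp (-(s ^ 2 / 2) * ‖x l - s⁻¹ • z‖ ^ 2)
      = Real.exp (-‖z‖ ^ 2 / 2) * cmW (s • x l) z := by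
    intro l
    unfold cmW
    rw [← Real.exp_add, norm_sub_sq_real, real_inner_smul_left, real_inner_smul_right, norm_smul,
      norm_smul, Real.norm_eq_abs, Real.norm_eq_abs, abs_of_pos hs, abs_of_pos (inv_pos.2 hs)]
    congr 1
    field_simp
    ring
  unfold rho
  simp_rw [h, ← Finset.mul_sum]
  rw [mul_div_mul_left _ _ (Real.exp_pos _).ne']

lemma cmW_pos {d : ℕ} (c z : EuclideanSpace ℝ (Fin d)) : 0 < cmW c z := Real.exp_pos _

lemma cmW_sqrt (d : ℕ) (s : ℝ) (u v z : EuclideanSpace ℝ (Fin d)) :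
    Real.sqrt (cmW (s • u) z * cmW (s • v) z)
      = Real.exp (-(s ^ 2 * ‖u - v‖ ^ 2 / 8)) * cmW ((s / 2) • (u + v)) z := by
  rw [Real.sqrt_eq_iff_mul_self_eq (by unfold cmW; positivity) (by unfold cmW; positivity)]
  unfold cmW
  simp_rw [← Real.exp_add]
  congr 1
  simp only [norm_smul, mul_pow, norm_add_sq_real, norm_sub_sq_real, real_inner_smul_left,
    inner_add_left, Real.norm_eq_abs, sq_abs]
  ring

lemma gap_formula (d n : ℕ) (hd : 1 ≤ d) (hn : 1 ≤ n) (x : Fin n → EuclideanSpace ℝ (Fin d))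
    (hvar : 1 / ((d : ℝ) * n) * ∑ i, ‖x i‖ ^ 2 = 1) (s : ℝ) (hs : 0 < s) :
    0 ≤ 1 - lamSep d n x s ∧
    1 - lamSep d n x s ≤ (1 / ((d : ℝ) * n)) * ∑ i, ∑ k,
      (1 / 4) * ‖x i - x k‖ ^ 2 * Real.exp (-(s ^ 2 * ‖x i - x k‖ ^ 2 / 8)) := by
  have hd' : (0 : ℝ) < d := by exact_mod_cast hd
  have hn' : (0 : ℝ) < n := by exact_mod_cast hn
  have : Nonempty (Fin n) := ⟨⟨0, hn⟩⟩
  set γ := _root_.stdGaussian d with hγ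
  let W : EuclideanSpace ℝ (Fin d) → ℝ := fun z => ∑ l, cmW (s • x l) z
  have hW : ∀ z, 0 < W z := fun z =>
    Finset.sum_pos (fun l _ => cmW_pos _ _) Finset.univ_nonempty
  let N : EuclideanSpace ℝ (Fin d) → ℝ := fun z =>
    ‖∑ i, (cmW (s • x i) z / W z) • x i‖ ^ 2
  have hNle : ∀ z, W z * N z ≤ ∑ j, cmW (s • x j) z * ‖x j‖ ^ 2 := by
    intro z
    have := var_identity n (fun i => cmW (s • x i) z) x (hW z)
    have h2 : 0 ≤ ∑ i, ∑ k, (1 / 2) * (cmW (s • x i) z * cmW (s • x k) z / (∑ l, cmW (s • x l) z))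
        * ‖x i - x k‖ ^ 2 := by
      refine Finset.sum_nonneg fun i _ => Finset.sum_nonneg fun k _ => ?_
      exact mul_nonneg (mul_nonneg (by norm_num) (div_nonneg (mul_nonneg (cmW_pos _ _).le
        (cmW_pos _ _).le) (hW z).le)) (sq_nonneg _)
    change _ - W z * N z = _ at this
    linarith
  have hcmeas : ∀ c : EuclideanSpace ℝ (Fin d), Continuous fun z => cmW c z := by
    intro c; unfold cmW; fun_prop
  have hWc : Continuous W := continuous_finsetSum _ fun l _ => hcmeas _
  have hNc : Continuous N := by
    refine (continuous_norm.comp (continuous_finsetSum _ fun i _ => ?_)).pow 2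
    exact ((hcmeas _).div hWc fun z => (hW z).ne').smul continuous_const
  have hint1 : Integrable (fun z => ∑ j, cmW (s • x j) z * ‖x j‖ ^ 2) γ :=
    integrable_finsetSum _ fun j _ => (integrable_cmW d _).mul_const _
  have hNn : ∀ z, 0 ≤ N z := fun z => sq_nonneg _
  have hint2 : ∀ j, Integrable (fun z => cmW (s • x j) z * N z) γ := by
    intro j
    refine hint1.mono' ((hcmeas _).mul hNc).aestronglyMeasurable ?_
    filter_upwards with z
    rw [Real.norm_eq_abs, abs_of_nonneg (mul_nonneg (cmW_pos _ _).le (hNn z))]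
    refine le_trans ?_ (hNle z)
    refine mul_le_mul_of_nonneg_right ?_ (hNn z)
    exact Finset.single_le_sum (f := fun l => cmW (s • x l) z)
      (fun l _ => (cmW_pos _ _).le) (Finset.mem_univ j)
  have hlam : ∑ j, ∫ z, ‖∑ i, rho d n s x i (x j + s⁻¹ • z) • x i‖ ^ 2 ∂γ
      = ∫ z, W z * N z ∂γ := by
    have h1 : ∀ j, ∫ z, ‖∑ i, rho d n s x i (x j + s⁻¹ • z) • x i‖ ^ 2 ∂γ
        = ∫ z, cmW (s • x j) z * N z ∂γ := by
      intro j
      rw [← gauss_shift_integral d (s • x j) N]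
      congr 1
      ext z
      have : x j + s⁻¹ • z = s⁻¹ • (s • x j + z) := by
        rw [smul_add, smul_smul, inv_mul_cancel₀ hs.ne', one_smul]
      rw [this]
      simp_rw [rho_eq d n s hs x]
      rfl
    simp_rw [h1]
    rw [← integral_finsetSum _ fun j _ => hint2 j]
    congr 1
    ext z
    rw [← Finset.sum_mul]
  have hone : ∑ i, ‖x i‖ ^ 2 = ∫ z, ∑ j, cmW (s • x j) z * ‖x j‖ ^ 2 ∂γ := by
    rw [integral_finsetSum _ fun j _ => (integrable_cmW d _).mul_const _]
    simp_rw [integral_mul_const, integral_cmW, one_mul]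
  have hWN : Integrable (fun z => W z * N z) γ := by
    have := integrable_finsetSum (Finset.univ : Finset (Fin n)) fun j _ => hint2 j
    simpa only [← Finset.sum_mul] using this
  have hgap : 1 - lamSep d n x s = (1 / ((d : ℝ) * n)) *
      ∫ z, (∑ j, cmW (s • x j) z * ‖x j‖ ^ 2 - W z * N z) ∂γ := by
    rw [integral_sub hint1 hWN, ← hone, ← hlam, mul_sub, hvar]
    rfl
  rw [hgap]
  constructor
  · refine mul_nonneg (by positivity) (integral_nonneg fun z => ?_)
    exact sub_nonneg.2 (hNle z)
  · refine mul_le_mul_of_nonneg_left ?_ (by positivity)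
    have hR : ∑ i, ∑ k, (1 / 4) * ‖x i - x k‖ ^ 2 * Real.exp (-(s ^ 2 * ‖x i - x k‖ ^ 2 / 8))
        = ∫ z, ∑ i, ∑ k, (1 / 4) * ‖x i - x k‖ ^ 2 *
          Real.exp (-(s ^ 2 * ‖x i - x k‖ ^ 2 / 8)) * cmW ((s / 2) • (x i + x k)) z ∂γ := by
      rw [integral_finsetSum _ fun i _ => integrable_finsetSum _ fun k _ =>
        (integrable_cmW d _).const_mul _]
      refine Finset.sum_congr rfl fun i _ => ?_
      rw [integral_finsetSum _ fun k _ => (integrable_cmW d _).const_mul _]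
      refine Finset.sum_congr rfl fun k _ => ?_
      rw [integral_const_mul, integral_cmW, mul_one]
    rw [hR]
    refine integral_mono (hint1.sub hWN) (integrable_finsetSum _ fun i _ =>
      integrable_finsetSum _ fun k _ => (integrable_cmW d _).const_mul _) fun z => ?_
    have := var_identity n (fun i => cmW (s • x i) z) x (hW z)
    change _ - W z * N z = _ at this
    change _ - W z * N z ≤ _
    rw [this]
    refine Finset.sum_le_sum fun i _ => Finset.sum_le_sum fun k _ => ?_
    by_cases hik : i = k
    · subst hik; simp
    rw [mul_assoc (1 / 4 * _), ← cmW_sqrt]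
    have h1 := cmW_pos (s • x i) z
    have h2 := cmW_pos (s • x k) z
    have hle : cmW (s • x i) z + cmW (s • x k) z ≤ ∑ l, cmW (s • x l) z := by
      rw [← Finset.sum_pair hik (f := fun l => cmW (s • x l) z)]
      exact Finset.sum_le_sum_of_subset_of_nonneg (Finset.subset_univ _)
        fun l _ _ => (cmW_pos _ _).le
    set p := cmW (s • x i) z
    set q := cmW (s • x k) z
    have hsq : Real.sqrt (p * q) ^ 2 = p * q := Real.sq_sqrt (by positivity)
    have hsp : 0 < Real.sqrt (p * q) := Real.sqrt_pos.2 (by positivity)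
    have hamgm : 2 * Real.sqrt (p * q) ≤ p + q := by
      apply le_of_sq_le_sq _ (by positivity)
      nlinarith [sq_nonneg (p - q)]
    have : p * q / (∑ l, cmW (s • x l) z) ≤ Real.sqrt (p * q) / 2 := by
      rw [div_le_iff₀ (hW z)]
      nlinarith
    calc _ ≤ 1 / 2 * (Real.sqrt (p * q) / 2) * ‖x i - x k‖ ^ 2 := by gcongr
      _ = _ := by ring

lemma sum_dist_le (d n : ℕ) (hd : 1 ≤ d) (hn : 1 ≤ n) (x : Fin n → EuclideanSpace ℝ (Fin d))
    (hmean : (n : ℝ)⁻¹ • ∑ i, x i = 0)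
    (hvar : 1 / ((d : ℝ) * n) * ∑ i, ‖x i‖ ^ 2 = 1) :
    Real.sqrt 8 * ∑ i, ∑ k, ‖x i - x k‖ ≤ 4 * n ^ 2 * Real.sqrt d := by
  have hd' : (0 : ℝ) < d := by exact_mod_cast hd
  have hn' : (0 : ℝ) < n := by exact_mod_cast hn
  have hm : ∑ i, x i = 0 := by
    rcases smul_eq_zero.1 hmean with h | h
    · exact absurd h (inv_pos.2 hn').ne'
    · exact h
  have hv : ∑ i, ‖x i‖ ^ 2 = d * n := by
    field_simp at hvar
    linarith
  have hsq : ∑ i, ∑ k, ‖x i - x k‖ ^ 2 = 2 * n * (d * n) := by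
    have hin : ∑ i, ∑ k, inner ℝ (x i) (x k) = (0 : ℝ) := by
      simp_rw [← inner_sum, hm, inner_zero_right, Finset.sum_const_zero]
    simp_rw [norm_sub_sq_real, Finset.sum_add_distrib, Finset.sum_sub_distrib, ← Finset.mul_sum]
    rw [hin, hv]
    simp only [Finset.sum_const, Finset.card_univ, Fintype.card_fin, nsmul_eq_mul,
      ← Finset.mul_sum, hv]
    ring
  have hcs : (∑ i, ∑ k, ‖x i - x k‖) ^ 2 ≤ n ^ 2 * (2 * n * (d * n)) := by
    rw [← hsq, ← Fintype.sum_prod_type' (f := fun i k => ‖x i - x k‖),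
      ← Fintype.sum_prod_type' (f := fun i k => ‖x i - x k‖ ^ 2)]
    have := sq_sum_le_card_mul_sum_sq (s := (Finset.univ : Finset (Fin n × Fin n)))
      (f := fun p => ‖x p.1 - x p.2‖)
    simp only [Finset.card_univ, Fintype.card_prod, Fintype.card_fin] at this
    push_cast at this
    rw [sq (n : ℝ)]
    exact this
  apply le_of_sq_le_sq _ (by positivity)
  rw [mul_pow, mul_pow, Real.sq_sqrt (by norm_num), Real.sq_sqrt hd'.le]
  nlinarith

/-- antiderivative -/
noncomputable def KK (d n : ℕ) (x : Fin n → EuclideanSpace ℝ (Fin d)) (u : ℝ) : ℝ :=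
  ∑ i, ∑ k, Real.sqrt 8 * ‖x i - x k‖ * Real.arctan (‖x i - x k‖ / Real.sqrt 8 * u)

lemma KK_hasDerivAt (d n : ℕ) (x : Fin n → EuclideanSpace ℝ (Fin d)) (u : ℝ) :
    HasDerivAt (KK d n x) (∑ i, ∑ k, ‖x i - x k‖ ^ 2 / (1 + u ^ 2 * ‖x i - x k‖ ^ 2 / 8)) u := by
  unfold KK
  refine HasDerivAt.fun_sum fun i _ => HasDerivAt.fun_sum fun k _ => ?_
  have h := (((hasDerivAt_id u).const_mul (‖x i - x k‖ / Real.sqrt 8)).arctan).const_mul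
    (Real.sqrt 8 * ‖x i - x k‖)
  convert! h using 1
  have h8 : Real.sqrt 8 ^ 2 = 8 := Real.sq_sqrt (by norm_num)
  have h8' : Real.sqrt 8 ≠ 0 := by positivity
  simp only [id, mul_pow, div_pow, h8]
  field_simp

lemma KK_diff (d n : ℕ) (x : Fin n → EuclideanSpace ℝ (Fin d)) (u v : ℝ) (hu : 0 ≤ u) :
    KK d n x v - KK d n x u ≤ (π / 2) * (Real.sqrt 8 * ∑ i, ∑ k, ‖x i - x k‖) := by
  unfold KK
  simp_rw [← Finset.sum_sub_distrib, Finset.mul_sum]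
  refine Finset.sum_le_sum fun i _ => Finset.sum_le_sum fun k _ => ?_
  have h1 := (Real.arctan_lt_pi_div_two (‖x i - x k‖ / Real.sqrt 8 * v)).le
  have h2 : 0 ≤ Real.arctan (‖x i - x k‖ / Real.sqrt 8 * u) :=
    Real.arctan_nonneg.2 (by positivity)
  have h3 : 0 ≤ Real.sqrt 8 * ‖x i - x k‖ := by positivity
  nlinarith

lemma gap_le_K (d n : ℕ) (hd : 1 ≤ d) (hn : 1 ≤ n) (x : Fin n → EuclideanSpace ℝ (Fin d))
    (hvar : 1 / ((d : ℝ) * n) * ∑ i, ‖x i‖ ^ 2 = 1) (s : ℝ) (hs : 0 < s) :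
    1 - lamSep d n x s ≤ (1 / (4 * ((d : ℝ) * n))) * ∑ i, ∑ k,
      ‖x i - x k‖ ^ 2 / (1 + s ^ 2 * ‖x i - x k‖ ^ 2 / 8) := by
  refine (gap_formula d n hd hn x hvar s hs).2.trans ?_
  have : (1 / (4 * ((d : ℝ) * n))) = 1 / ((d : ℝ) * n) * (1 / 4) := by
    rw [one_div_mul_one_div]; congr 1; ring
  rw [this, mul_assoc]
  refine mul_le_mul_of_nonneg_left ?_ (by positivity)
  simp_rw [Finset.mul_sum]
  refine Finset.sum_le_sum fun i _ => Finset.sum_le_sum fun k _ => ?_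
  rw [mul_assoc]
  refine mul_le_mul_of_nonneg_left ?_ (by norm_num)
  rw [div_eq_mul_inv]
  refine mul_le_mul_of_nonneg_left ?_ (by positivity)
  rw [Real.exp_neg]
  apply inv_anti₀ (by positivity)
  have := Real.add_one_le_exp (s ^ 2 * ‖x i - x k‖ ^ 2 / 8)
  simp only [div_eq_mul_inv] at this ⊢
  linarith

/-- Theorem 4.2: for a scheduler pair `(a_t, m_t)` with strictly increasing `a_t/m_t`
and Sobolev norms bounded by `M`, and any normalized finite dataset,
`0 ≤ ∫₀¹ β_t² (1 − λ(a_t/m_t)) dt ≤ 6 M² n / √d`, where `β_t = ȧ_t − a_t ṁ_t / m_t`.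
(This integral is the gap `E_c(a,m) − E(a,m)` between conditional and marginal
kinetic energies.) -/
theorem ke_gap_nonneg_and_le (d n : ℕ) (hd : 1 ≤ d) (hn : 1 ≤ n)
    (x : Fin n → EuclideanSpace ℝ (Fin d))
    (hmean : (n : ℝ)⁻¹ • ∑ i, x i = 0)
    (hvar : 1 / ((d : ℝ) * n) * ∑ i, ‖x i‖ ^ 2 = 1)
    (a m : ℝ → ℝ) (M : ℝ) (hM : 0 < M)
    (ha_nonneg : ∀ t ∈ Set.Icc (0 : ℝ) 1, 0 ≤ a t)
    (hm_nonneg : ∀ t ∈ Set.Icc (0 : ℝ) 1, 0 ≤ m t)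
    (ha_cont : ContinuousOn a (Set.Icc 0 1))
    (hm_cont : ContinuousOn m (Set.Icc 0 1))
    (ha_smooth : ContDiffOn ℝ (⊤ : ℕ∞) a (Set.Ioo 0 1))
    (hm_smooth : ContDiffOn ℝ (⊤ : ℕ∞) m (Set.Ioo 0 1))
    (ha0 : a 0 = 0) (ha1 : a 1 = 1) (hm0 : m 0 = 1) (hm1 : m 1 = 0)
    (hmono : StrictMonoOn (fun t => a t / m t) (Set.Ioo 0 1))
    (haM : ∀ t ∈ Set.Icc (0 : ℝ) 1, |a t| ≤ M)
    (haM' : ∀ t ∈ Set.Ioo (0 : ℝ) 1, |deriv a t| ≤ M)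
    (hmM : ∀ t ∈ Set.Icc (0 : ℝ) 1, |m t| ≤ M)
    (hmM' : ∀ t ∈ Set.Ioo (0 : ℝ) 1, |deriv m t| ≤ M) :
    0 ≤ ∫ t in (0 : ℝ)..1,
        (deriv a t - a t * deriv m t / m t) ^ 2 * (1 - lamSep d n x (a t / m t)) ∧
    ∫ t in (0 : ℝ)..1,
        (deriv a t - a t * deriv m t / m t) ^ 2 * (1 - lamSep d n x (a t / m t))
      ≤ 6 * M ^ 2 * n / Real.sqrt d := by
  have hd' : (0 : ℝ) < d := by exact_mod_cast hd
  have hn' : (0 : ℝ) < n := by exact_mod_cast hn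
  -- positivity of `m` and of the ratio
  have hmem : ∀ t ∈ Set.Ioo (0 : ℝ) 1, t ∈ Set.Icc (0 : ℝ) 1 := fun t ht => ⟨ht.1.le, ht.2.le⟩
  have hspos : ∀ t ∈ Set.Ioo (0 : ℝ) 1, 0 < a t / m t := by
    intro t ht
    have h2 : t / 2 ∈ Set.Ioo (0 : ℝ) 1 := ⟨by linarith [ht.1], by linarith [ht.1, ht.2]⟩
    have h3 := hmono h2 ht (by linarith [ht.1])
    have h4 : 0 ≤ a (t / 2) / m (t / 2) :=
      div_nonneg (ha_nonneg _ (hmem _ h2)) (hm_nonneg _ (hmem _ h2))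
    exact lt_of_le_of_lt h4 h3
  have hmpos : ∀ t ∈ Set.Ioo (0 : ℝ) 1, 0 < m t := by
    intro t ht
    refine lt_of_le_of_ne (hm_nonneg t (hmem t ht)) fun h => ?_
    have := hspos t ht
    rw [← h, div_zero] at this
    exact lt_irrefl _ this
  have hsd : ∀ t ∈ Set.Ioo (0 : ℝ) 1, HasDerivAt (fun t => a t / m t)
      ((deriv a t * m t - a t * deriv m t) / m t ^ 2) t := by
    intro t ht
    have hnhds : Set.Ioo (0 : ℝ) 1 ∈ nhds t := isOpen_Ioo.mem_nhds ht
    have h1 : HasDerivAt a (deriv a t) t :=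
      ((ha_smooth.contDiffAt hnhds).differentiableAt (by simp)).hasDerivAt
    have h2 : HasDerivAt m (deriv m t) t :=
      ((hm_smooth.contDiffAt hnhds).differentiableAt (by simp)).hasDerivAt
    exact h1.div h2 (hmpos t ht).ne'
  have hsd_nonneg : ∀ t ∈ Set.Ioo (0 : ℝ) 1,
      0 ≤ (deriv a t * m t - a t * deriv m t) / m t ^ 2 := by
    intro t ht
    have h := (hmono.monotoneOn).derivWithin_nonneg (x := t)
    rwa [derivWithin_of_isOpen isOpen_Ioo ht, (hsd t ht).deriv] at h
  set f : ℝ → ℝ := fun t =>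
    (deriv a t - a t * deriv m t / m t) ^ 2 * (1 - lamSep d n x (a t / m t)) with hf
  have hf_nonneg : ∀ t ∈ Set.Ioo (0 : ℝ) 1, 0 ≤ f t := fun t ht =>
    mul_nonneg (sq_nonneg _) (gap_formula d n hd hn x hvar _ (hspos t ht)).1
  rw [intervalIntegral.integral_of_le zero_le_one, integral_Ioc_eq_integral_Ioo]
  refine ⟨setIntegral_nonneg measurableSet_Ioo hf_nonneg, ?_⟩
  by_cases hfi : IntegrableOn f (Set.Ioo 0 1)
  swap
  · rw [integral_undef hfi]
    positivity
  -- the comparison function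
  let C : ℝ := 2 * M ^ 2 * (1 / (4 * ((d : ℝ) * n)))
  have hC : 0 ≤ C := by positivity
  have hHd : ∀ t ∈ Set.Ioo (0 : ℝ) 1, HasDerivAt (fun t => C * KK d n x (a t / m t))
      (C * ((∑ i, ∑ k, ‖x i - x k‖ ^ 2 / (1 + (a t / m t) ^ 2 * ‖x i - x k‖ ^ 2 / 8))
        * ((deriv a t * m t - a t * deriv m t) / m t ^ 2))) t := by
    intro t ht
    have h := HasDerivAt.comp (h₂ := KK d n x) t (KK_hasDerivAt d n x (a t / m t)) (hsd t ht)
    exact h.const_mul C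
  have hle : ∀ t ∈ Set.Ioo (0 : ℝ) 1, f t ≤
      C * ((∑ i, ∑ k, ‖x i - x k‖ ^ 2 / (1 + (a t / m t) ^ 2 * ‖x i - x k‖ ^ 2 / 8))
        * ((deriv a t * m t - a t * deriv m t) / m t ^ 2)) := by
    intro t ht
    have hg := gap_le_K d n hd hn x hvar _ (hspos t ht)
    have hg0 := (gap_formula d n hd hn x hvar _ (hspos t ht)).1
    set S := ∑ i, ∑ k, ‖x i - x k‖ ^ 2 / (1 + (a t / m t) ^ 2 * ‖x i - x k‖ ^ 2 / 8)
    have hs0 := hsd_nonneg t ht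
    set v := (deriv a t * m t - a t * deriv m t) / m t ^ 2 with hv
    have hmp := hmpos t ht
    have hmv : m t ^ 2 * v = deriv a t * m t - a t * deriv m t := by
      rw [hv]; field_simp
    have hmv2 : m t ^ 2 * v ≤ 2 * M ^ 2 := by
      rw [hmv]
      have h1 : deriv a t * m t ≤ M * M := by
        refine (le_abs_self _).trans ?_
        rw [abs_mul]
        exact mul_le_mul (haM' t ht) (hmM t (hmem t ht)) (abs_nonneg _) hM.le
      have h2 : -(a t * deriv m t) ≤ M * M := by
        refine (neg_le_abs _).trans ?_
        rw [abs_mul]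
        exact mul_le_mul (haM t (hmem t ht)) (hmM' t ht) (abs_nonneg _) hM.le
      linarith
    have hb : (deriv a t - a t * deriv m t / m t) ^ 2 = (m t ^ 2 * v) * v := by
      rw [hv]; field_simp
    have hbv : (m t ^ 2 * v) * v ≤ 2 * M ^ 2 * v := mul_le_mul_of_nonneg_right hmv2 hs0
    change (deriv a t - a t * deriv m t / m t) ^ 2 * (1 - lamSep d n x (a t / m t)) ≤ _
    rw [hb]
    calc (m t ^ 2 * v) * v * (1 - lamSep d n x (a t / m t))
        ≤ (2 * M ^ 2 * v) * ((1 / (4 * ((d : ℝ) * n))) * S) :=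
          mul_le_mul hbv hg hg0 (by positivity)
      _ = C * (S * v) := by simp only [C]; ring
  have hbound : C * ((π / 2) * (Real.sqrt 8 * ∑ i, ∑ k, ‖x i - x k‖))
      ≤ 6 * M ^ 2 * n / Real.sqrt d := by
    have h1 := sum_dist_le d n hd hn x hmean hvar
    have hsd0 : 0 < Real.sqrt d := Real.sqrt_pos.2 hd'
    have hsq : Real.sqrt d ^ 2 = d := Real.sq_sqrt hd'.le
    have hpi := Real.pi_le_four
    have hpi0 := Real.pi_pos
    calc C * ((π / 2) * (Real.sqrt 8 * ∑ i, ∑ k, ‖x i - x k‖))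
        ≤ C * ((4 / 2) * (4 * n ^ 2 * Real.sqrt d)) := by gcongr
      _ = 4 * M ^ 2 * n / Real.sqrt d := by
          simp only [C]
          rw [← hsq, Real.sqrt_sq hsd0.le]
          field_simp
      _ ≤ 6 * M ^ 2 * n / Real.sqrt d := by gcongr; norm_num
  have hpq : ∀ p q : ℝ, 0 < p → p ≤ q → q < 1 →
      ∫ t in Set.Ioc p q, f t ≤ 6 * M ^ 2 * n / Real.sqrt d := by
    intro p q hp hpq hq
    have hsub : ∀ t ∈ Set.Icc p q, t ∈ Set.Ioo (0 : ℝ) 1 := fun t ht =>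
      ⟨by linarith [ht.1], by linarith [ht.2]⟩
    have h := intervalIntegral.integral_le_sub_of_hasDeriv_right_of_le hpq
      (g := fun t => C * KK d n x (a t / m t)) (φ := f)
      (fun t ht => (hHd t (hsub t ht)).continuousAt.continuousWithinAt)
      (fun t ht => (hHd t (hsub t ⟨ht.1.le, ht.2.le⟩)).hasDerivWithinAt)
      (hfi.mono_set hsub)
      (fun t ht => hle t (hsub t ⟨ht.1.le, ht.2.le⟩))
    rw [intervalIntegral.integral_of_le hpq] at h
    refine h.trans (le_trans ?_ hbound)
    rw [← mul_sub]
    exact mul_le_mul_of_nonneg_left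
      (KK_diff d n x _ _ (hspos p (hsub p ⟨le_refl p, hpq⟩)).le) hC
  -- exhaust the open interval
  have hp_lim : Filter.Tendsto (fun k : ℕ => 1 / ((k : ℝ) + 1) / 2) Filter.atTop (nhds 0) := by
    simpa using (tendsto_one_div_add_atTop_nhds_zero_nat (𝕜 := ℝ)).div_const 2
  have hq_lim : Filter.Tendsto (fun k : ℕ => 1 - 1 / ((k : ℝ) + 1) / 2) Filter.atTop (nhds 1) := by
    simpa using hp_lim.const_sub 1
  have hcov := aecover_Ioo_of_Ioc (μ := volume) hp_lim hq_lim
  have hlim := hcov.integral_tendsto_of_countably_generated hfi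
  refine le_of_tendsto' hlim fun k => ?_
  have hk : 0 < 1 / ((k : ℝ) + 1) := by positivity
  have hk1 : 1 / ((k : ℝ) + 1) ≤ 1 := by
    rw [div_le_one (by positivity)]; linarith [(Nat.cast_nonneg k : (0 : ℝ) ≤ k)]
  rw [Measure.restrict_restrict measurableSet_Ioc, Set.inter_eq_left.2]
  · exact hpq _ _ (by linarith) (by linarith) (by linarith)
  · intro t ht
    exact ⟨by linarith [ht.1], by linarith [ht.2]⟩
end
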